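/- arXiv:2411.04322 — 2 statements merged into one kernel-verified Lean document; each statement's English description precedes it below -/
import Mathlib

section
/- Let S be a real random variable with convex support Ω_S ⊆ ℝ and Lebesgue density f_S of class C¹, and let Z_t = e^{−t}S + √(1−e^{−2t})Z with Z standard Gaussian independent of S, having density f_{Z_t}. Then for every x ∈ Ω_S, the map t ↦ √(f_{Z_t}(x)) is continuous on [0,∞) and continuously differentiable on (0,∞); in particular, f_{Z_t}(x) > 0 for every t > 0 and x ∈ Ω_S. -/
open MeasureTheory ProbabilityTheory Real Filter

noncomputable section

/-- The standard Gaussian density on ℝ. -/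
def stdGaussianDensity (x : ℝ) : ℝ := (Real.sqrt (2 * Real.pi))⁻¹ * Real.exp (-(x ^ 2) / 2)

/-- Hellinger distance between a random variable with Lebesgue density `f`
and a standard Gaussian. -/
def hellingerToGauss (f : ℝ → ℝ) : ℝ :=
  Real.sqrt ((1 / 2) * ∫ x : ℝ, (Real.sqrt (f x) - Real.sqrt (stdGaussianDensity x)) ^ 2)

/-- `S` has Lebesgue density `f` under `μ`. -/
def HasLebDensity {Ω : Type*} [MeasurableSpace Ω] (μ : Measure Ω) (S : Ω → ℝ) (f : ℝ → ℝ) :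
    Prop :=
  Measure.map S μ = volume.withDensity (fun x => ENNReal.ofReal (f x))

/-- `ρ` is a (first-order) score function for `S`:
`E[ρ(S)Ψ(S)] = -E[Ψ'(S)]` for all `Ψ ∈ C_c^∞(ℝ)`, with `ρ ∈ L¹(S)`. -/
def IsScoreFun {Ω : Type*} [MeasurableSpace Ω] (μ : Measure Ω) (S : Ω → ℝ) (ρ : ℝ → ℝ) :
    Prop :=
  Integrable (fun ω => ρ (S ω)) μ ∧
    ∀ Ψ : ℝ → ℝ, ContDiff ℝ (⊤ : ℕ∞) Ψ → HasCompactSupport Ψ →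
      ∫ ω, ρ (S ω) * Ψ (S ω) ∂μ = -∫ ω, deriv Ψ (S ω) ∂μ

/-- `I` is a second-order score function for `S`:
`E[I(S)Ψ(S)] = E[Ψ''(S)]` for all `Ψ ∈ C_c^∞(ℝ)`, with `I ∈ L¹(S)`. -/
def IsScoreFun2 {Ω : Type*} [MeasurableSpace Ω] (μ : Measure Ω) (S : Ω → ℝ) (I : ℝ → ℝ) :
    Prop :=
  Integrable (fun ω => I (S ω)) μ ∧
    ∀ Ψ : ℝ → ℝ, ContDiff ℝ (⊤ : ℕ∞) Ψ → HasCompactSupport Ψ →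
      ∫ ω, I (S ω) * Ψ (S ω) ∂μ = ∫ ω, deriv (deriv Ψ) (S ω) ∂μ

/-- The L² norm `‖T‖₂ = (E|T|²)^{1/2}` of a random variable. -/
def l2norm {Ω : Type*} [MeasurableSpace Ω] (μ : Measure Ω) (T : Ω → ℝ) : ℝ :=
  Real.sqrt (∫ ω, (T ω) ^ 2 ∂μ)

/-- The k-th probabilist's Hermite polynomial, evaluated at `x : ℝ`. -/
def hermiteR (k : ℕ) (x : ℝ) : ℝ := Polynomial.aeval x (Polynomial.hermite k)


/-- The density of the Ornstein–Uhlenbeck interpolant `Z_t = e^{-t}S + √(1-e^{-2t})Z`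
for a variable `S` with density `fS` (equal to `fS` at `t = 0`). -/
def ouDensity (fS : ℝ → ℝ) (t x : ℝ) : ℝ :=
  if t = 0 then fS x
  else ∫ y : ℝ,
    stdGaussianDensity (y / Real.sqrt (1 - Real.exp (-2 * t))) / Real.sqrt (1 - Real.exp (-2 * t))
      * (fS ((x - y) / Real.exp (-t)) / Real.exp (-t))

lemma stdGaussianDensity_eq_gaussianPDFReal :
    stdGaussianDensity = gaussianPDFReal 0 1 := by
  ext x
  simp [stdGaussianDensity, gaussianPDFReal]

lemma stdGaussianDensity_pos (x : ℝ) : 0 < stdGaussianDensity x := by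
  rw [stdGaussianDensity]
  positivity

lemma continuous_stdGaussianDensity : Continuous stdGaussianDensity := by
  unfold stdGaussianDensity
  fun_prop

lemma integrable_stdGaussianDensity : Integrable stdGaussianDensity := by
  rw [stdGaussianDensity_eq_gaussianPDFReal]
  exact integrable_gaussianPDFReal 0 1

lemma integral_stdGaussianDensity : ∫ x, stdGaussianDensity x = 1 := by
  rw [stdGaussianDensity_eq_gaussianPDFReal]
  exact integral_gaussianPDFReal_eq_one 0 one_ne_zero

lemma sq_mul_exp_neg_sq_half_le (u : ℝ) : u ^ 2 * exp (-(u ^ 2) / 2) ≤ 2 := by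
  have h := Real.add_one_le_exp (u ^ 2 / 2)
  have h2 : exp (-(u ^ 2) / 2) * exp (u ^ 2 / 2) = 1 := by
    rw [← Real.exp_add, show -(u ^ 2) / 2 + u ^ 2 / 2 = 0 by ring, Real.exp_zero]
  nlinarith [Real.exp_pos (-(u ^ 2) / 2)]

lemma exp_neg_sq_half_le_one (u : ℝ) : exp (-(u ^ 2) / 2) ≤ 1 :=
  Real.exp_le_one_iff.2 (by nlinarith [sq_nonneg u])

lemma abs_mul_exp_neg_sq_half_le (u : ℝ) : |u| * exp (-(u ^ 2) / 2) ≤ 2 := by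
  have h1 := sq_mul_exp_neg_sq_half_le u
  have h2 := exp_neg_sq_half_le_one u
  have h3 : |u| ≤ (1 + u ^ 2) / 2 := by nlinarith [sq_nonneg (|u| - 1), sq_abs u]
  nlinarith [mul_le_mul_of_nonneg_right h3 (Real.exp_pos (-(u ^ 2) / 2)).le]

lemma inv_sqrt_two_pi_le_one : (Real.sqrt (2 * Real.pi))⁻¹ ≤ 1 := by
  apply inv_le_one_of_one_le₀
  rw [Real.one_le_sqrt]
  linarith [Real.pi_gt_three]

lemma stdGaussianDensity_le_one (u : ℝ) : stdGaussianDensity u ≤ 1 :=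
  mul_le_one₀ inv_sqrt_two_pi_le_one (Real.exp_pos _).le (exp_neg_sq_half_le_one u)

lemma sq_mul_stdGaussianDensity_le (u : ℝ) : u ^ 2 * stdGaussianDensity u ≤ 2 := by
  have h1 := sq_mul_exp_neg_sq_half_le u
  have h2 := inv_sqrt_two_pi_le_one
  have h3 : (0 : ℝ) ≤ (Real.sqrt (2 * Real.pi))⁻¹ := by positivity
  have h4 : 0 ≤ u ^ 2 * exp (-(u ^ 2) / 2) := by positivity
  calc u ^ 2 * stdGaussianDensity u
      = (Real.sqrt (2 * Real.pi))⁻¹ * (u ^ 2 * exp (-(u ^ 2) / 2)) := by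
        rw [stdGaussianDensity]; ring
    _ ≤ 1 * 2 := by gcongr
    _ = 2 := by ring

/-- A Gaussian integral whose centre and scale depend smoothly on a parameter is `C¹` in it. -/
lemma contDiffOn_integral_exp_neg_sq_half {U : Set ℝ} (hU : IsOpen U) {p b : ℝ → ℝ}
    (hp : ContDiffOn ℝ 1 p U) (hb : ContDiffOn ℝ 1 b U) (hb0 : ∀ t ∈ U, b t ≠ 0)
    {f : ℝ → ℝ} (hf : Integrable f) :
    ContDiffOn ℝ 1 (fun t => ∫ s, exp (-((p t - b t * s) ^ 2) / 2) * f s) U := by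
  have hp' := hp.continuousOn_deriv_of_isOpen hU le_rfl
  have hb' := hb.continuousOn_deriv_of_isOpen hU le_rfl
  set D : ℝ → ℝ → ℝ := fun t s =>
    (-((p t - b t * s) * (deriv p t - deriv b t * s)) * exp (-((p t - b t * s) ^ 2) / 2)) * f s
    with hD
  set B : ℝ → ℝ := fun t => 2 * |deriv p t - deriv b t * p t / b t| + 2 * |deriv b t / b t| with hB
  have hBc : ContinuousOn B U := by
    have := hp.continuousOn
    have := hb.continuousOn
    fun_prop (disch := assumption)
  have hbound : ∀ t ∈ U, ∀ s, ‖D t s‖ ≤ B t * ‖f s‖ := by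
    intro t ht s
    have hbt := hb0 t ht
    rw [hD, norm_mul]
    refine mul_le_mul_of_nonneg_right ?_ (norm_nonneg _)
    set u := p t - b t * s with hu
    have hs : deriv p t - deriv b t * s
        = (deriv p t - deriv b t * p t / b t) + deriv b t / b t * u := by
      rw [hu]; field_simp; ring
    rw [hs, norm_mul, norm_neg, norm_mul, Real.norm_eq_abs, Real.norm_eq_abs, Real.norm_eq_abs,
      abs_of_pos (Real.exp_pos _)]
    have h1 := abs_mul_exp_neg_sq_half_le u
    have h2 := sq_mul_exp_neg_sq_half_le u
    set c := deriv p t - deriv b t * p t / b t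
    set d := deriv b t / b t
    have h3 : |c + d * u| ≤ |c| + |d| * |u| := by
      rw [← abs_mul]; exact abs_add_le _ _
    calc |u| * |c + d * u| * exp (-(u ^ 2) / 2)
        ≤ |u| * (|c| + |d| * |u|) * exp (-(u ^ 2) / 2) := by gcongr
      _ = |c| * (|u| * exp (-(u ^ 2) / 2)) + |d| * (|u| ^ 2 * exp (-(u ^ 2) / 2)) := by ring
      _ = |c| * (|u| * exp (-(u ^ 2) / 2)) + |d| * (u ^ 2 * exp (-(u ^ 2) / 2)) := by rw [sq_abs]
      _ ≤ |c| * 2 + |d| * 2 := by gcongr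
      _ = 2 * |c| + 2 * |d| := by ring
  have hlocal : ∀ t₀ ∈ U, ∀ᶠ t in nhds t₀, ∀ s, ‖D t s‖ ≤ (B t₀ + 1) * ‖f s‖ := by
    intro t₀ ht₀
    have hlt : ∀ᶠ t in nhds t₀, B t < B t₀ + 1 :=
      (hBc.continuousAt (hU.mem_nhds ht₀)).eventually_lt continuousAt_const (by simp)
    filter_upwards [hlt, hU.mem_nhds ht₀] with t h1 h2 s
    exact (hbound t h2 s).trans (by gcongr)
  have hDmeas : ∀ t, AEStronglyMeasurable (D t) volume := fun t =>
    AEStronglyMeasurable.mul (Continuous.aestronglyMeasurable (by fun_prop)) hf.1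
  have hderiv : ∀ t₀ ∈ U,
      HasDerivAt (fun t => ∫ s, exp (-((p t - b t * s) ^ 2) / 2) * f s) (∫ s, D t₀ s) t₀ := by
    intro t₀ ht₀
    refine (hasDerivAt_integral_of_dominated_loc_of_deriv_le
      (bound := fun s => (B t₀ + 1) * ‖f s‖)
      (inter_mem (hlocal t₀ ht₀) (hU.mem_nhds ht₀)) ?_ ?_ (hDmeas t₀) ?_
      (hf.norm.const_mul _) ?_).2
    · exact Eventually.of_forall fun t =>
        AEStronglyMeasurable.mul (Continuous.aestronglyMeasurable (by fun_prop)) hf.1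
    · refine hf.bdd_mul (c := 1) (Continuous.aestronglyMeasurable (by fun_prop)) ?_
      refine Eventually.of_forall fun s => ?_
      rw [Real.norm_eq_abs, abs_of_pos (Real.exp_pos _)]
      exact exp_neg_sq_half_le_one _
    · exact Eventually.of_forall fun s t ht => ht.1 s
    · refine Eventually.of_forall fun s t ht => ?_
      have h1 := ((hp.differentiableOn one_ne_zero).differentiableAt
        (hU.mem_nhds ht.2)).hasDerivAt
      have h2 := ((hb.differentiableOn one_ne_zero).differentiableAt
        (hU.mem_nhds ht.2)).hasDerivAt
      have h3 := (((((h1.sub (h2.mul_const s)).pow 2).neg).div_const 2).exp).mul_const (f s)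
      refine h3.congr_deriv ?_
      simp [hD]
      ring
  rw [show (1 : WithTop ℕ∞) = 0 + 1 from rfl, contDiffOn_succ_iff_deriv_of_isOpen hU]
  refine ⟨fun t ht => (hderiv t ht).differentiableAt.differentiableWithinAt, by simp, ?_⟩
  rw [contDiffOn_zero]
  refine ContinuousOn.congr (f := fun t => ∫ s, D t s) (fun t₀ ht₀ => ?_)
    fun t ht => (hderiv t ht).deriv
  refine ContinuousAt.continuousWithinAt (continuousAt_of_dominated
    (bound := fun s => (B t₀ + 1) * ‖f s‖) (Eventually.of_forall hDmeas) ?_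
    (hf.norm.const_mul _) ?_)
  · filter_upwards [hlocal t₀ ht₀] with t ht
    exact Eventually.of_forall ht
  · refine Eventually.of_forall fun s => ?_
    have h1 := hp.continuousOn.continuousAt (hU.mem_nhds ht₀)
    have h2 := hb.continuousOn.continuousAt (hU.mem_nhds ht₀)
    have h3 := hp'.continuousAt (hU.mem_nhds ht₀)
    have h4 := hb'.continuousAt (hU.mem_nhds ht₀)
    fun_prop

lemma one_sub_exp_neg_two_mul_pos {t : ℝ} (ht : 0 < t) : 0 < 1 - Real.exp (-2 * t) := by
  have : Real.exp (-2 * t) < 1 := Real.exp_lt_one_iff.2 (by linarith)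
  linarith

lemma tendsto_sqrt_one_sub_exp_nhdsGT_zero :
    Tendsto (fun t : ℝ => Real.sqrt (1 - Real.exp (-2 * t))) (nhdsWithin 0 (Set.Ioi 0))
      (nhds 0) := by
  have h : Continuous fun t : ℝ => Real.sqrt (1 - Real.exp (-2 * t)) := by fun_prop
  simpa using (h.tendsto 0).mono_left nhdsWithin_le_nhds

lemma ouDensity_eq_integral_kernel (f : ℝ → ℝ) {t : ℝ} (ht : t ≠ 0) (x : ℝ) :
    ouDensity f t x = ∫ s, stdGaussianDensity
      ((x - Real.exp (-t) * s) / Real.sqrt (1 - Real.exp (-2 * t)))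
        / Real.sqrt (1 - Real.exp (-2 * t)) * f s := by
  have he := Real.exp_pos (-t)
  set H : ℝ → ℝ := fun s => stdGaussianDensity
      ((x - Real.exp (-t) * s) / Real.sqrt (1 - Real.exp (-2 * t)))
        / Real.sqrt (1 - Real.exp (-2 * t)) * f s with hH
  have h1 : ouDensity f t x = ∫ y, H ((x - y) / Real.exp (-t)) / Real.exp (-t) := by
    rw [ouDensity, if_neg ht]
    congr 1 with y
    simp only [hH]
    rw [mul_div_cancel₀ _ he.ne', sub_sub_cancel]
    ring
  rw [h1, integral_sub_left_eq_self (fun y => H (y / Real.exp (-t)) / Real.exp (-t)) volume x,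
    integral_div, Measure.integral_comp_div, abs_of_pos he, smul_eq_mul,
    mul_div_cancel_left₀ _ he.ne']

lemma ouDensity_eq_integral_stdGaussianDensity (f : ℝ → ℝ) {t : ℝ} (ht : 0 < t) (x : ℝ) :
    ouDensity f t x = ∫ z, stdGaussianDensity z *
      (f ((x - Real.sqrt (1 - Real.exp (-2 * t)) * z) / Real.exp (-t)) / Real.exp (-t)) := by
  have hσ := Real.sqrt_pos.2 (one_sub_exp_neg_two_mul_pos ht)
  set σ := Real.sqrt (1 - Real.exp (-2 * t)) with hσdef
  set P : ℝ → ℝ := fun z =>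
    stdGaussianDensity z * (f ((x - σ * z) / Real.exp (-t)) / Real.exp (-t)) with hP
  have h1 : ouDensity f t x = ∫ y, P (y / σ) / σ := by
    rw [ouDensity, if_neg ht.ne', ← hσdef]
    congr 1 with y
    simp only [hP]
    rw [mul_div_cancel₀ _ hσ.ne']
    ring
  rw [h1, integral_div, Measure.integral_comp_div, abs_of_pos hσ, smul_eq_mul,
    mul_div_cancel_left₀ _ hσ.ne']

lemma integrable_ouDensity_kernel_mul {f : ℝ → ℝ} (hf : Integrable f) (t x : ℝ) :
    Integrable fun s => stdGaussianDensity
      ((x - Real.exp (-t) * s) / Real.sqrt (1 - Real.exp (-2 * t)))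
        / Real.sqrt (1 - Real.exp (-2 * t)) * f s := by
  refine hf.bdd_mul (c := 1 / Real.sqrt (1 - Real.exp (-2 * t))) ?_ ?_
  · have := continuous_stdGaussianDensity
    exact Continuous.aestronglyMeasurable (by fun_prop)
  · refine Eventually.of_forall fun s => ?_
    rw [Real.norm_eq_abs,
      abs_of_nonneg (div_nonneg (stdGaussianDensity_pos _).le (Real.sqrt_nonneg _))]
    gcongr
    exact stdGaussianDensity_le_one _

lemma ouDensity_add {f g : ℝ → ℝ} (hf : Integrable f) (hg : Integrable g) {t : ℝ} (ht : t ≠ 0)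
    (x : ℝ) : ouDensity (f + g) t x = ouDensity f t x + ouDensity g t x := by
  rw [ouDensity_eq_integral_kernel _ ht, ouDensity_eq_integral_kernel _ ht,
    ouDensity_eq_integral_kernel _ ht, ← integral_add (integrable_ouDensity_kernel_mul hf t x)
      (integrable_ouDensity_kernel_mul hg t x)]
  simp only [Pi.add_apply, mul_add]

lemma ouDensity_pos {f : ℝ → ℝ} (hc : Continuous f) (hf : Integrable f) (h0 : 0 ≤ f)
    {s : ℝ} (hs : f s ≠ 0) {t : ℝ} (ht : 0 < t) (x : ℝ) : 0 < ouDensity f t x := by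
  have hσ := Real.sqrt_pos.2 (one_sub_exp_neg_two_mul_pos ht)
  have hK : ∀ s, 0 < stdGaussianDensity
      ((x - Real.exp (-t) * s) / Real.sqrt (1 - Real.exp (-2 * t)))
        / Real.sqrt (1 - Real.exp (-2 * t)) := fun s => div_pos (stdGaussianDensity_pos _) hσ
  rw [ouDensity_eq_integral_kernel _ ht.ne', integral_pos_iff_support_of_nonneg
    (fun s => mul_nonneg (hK s).le (h0 s)) (integrable_ouDensity_kernel_mul hf t x)]
  refine IsOpen.measure_pos volume ?_ ⟨s, mul_ne_zero (hK s).ne' hs⟩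
  have := continuous_stdGaussianDensity
  exact ((show Continuous fun s => stdGaussianDensity
    ((x - Real.exp (-t) * s) / Real.sqrt (1 - Real.exp (-2 * t)))
      / Real.sqrt (1 - Real.exp (-2 * t)) by fun_prop).mul hc).isOpen_support

lemma contDiffOn_ouDensity {f : ℝ → ℝ} (hf : Integrable f) (x : ℝ) :
    ContDiffOn ℝ 1 (fun t => ouDensity f t x) (Set.Ioi 0) := by
  have hσpos : ∀ t ∈ Set.Ioi (0 : ℝ), 0 < Real.sqrt (1 - Real.exp (-2 * t)) :=
    fun t ht => Real.sqrt_pos.2 (one_sub_exp_neg_two_mul_pos ht)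
  have hσ : ContDiffOn ℝ 1 (fun t : ℝ => Real.sqrt (1 - Real.exp (-2 * t))) (Set.Ioi 0) :=
    ContDiffOn.sqrt (ContDiff.contDiffOn (by fun_prop))
      fun t ht => (one_sub_exp_neg_two_mul_pos ht).ne'
  have hp : ContDiffOn ℝ 1 (fun t : ℝ => x / Real.sqrt (1 - Real.exp (-2 * t))) (Set.Ioi 0) :=
    contDiffOn_const.div hσ fun t ht => (hσpos t ht).ne'
  have hb : ContDiffOn ℝ 1
      (fun t : ℝ => Real.exp (-t) / Real.sqrt (1 - Real.exp (-2 * t))) (Set.Ioi 0) :=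
    ContDiffOn.div (ContDiff.contDiffOn (by fun_prop)) hσ fun t ht => (hσpos t ht).ne'
  have hI := contDiffOn_integral_exp_neg_sq_half isOpen_Ioi hp hb
    (fun t ht => (div_pos (Real.exp_pos _) (hσpos t ht)).ne') hf
  refine ContDiffOn.congr (((contDiffOn_const (c := (Real.sqrt (2 * Real.pi))⁻¹)).div hσ
    fun t ht => (hσpos t ht).ne').mul hI) fun t ht => ?_
  rw [ouDensity_eq_integral_kernel _ (ne_of_gt ht), ← integral_const_mul]
  congr 1 with s
  rw [stdGaussianDensity, sub_div, mul_div_right_comm, Pi.div_apply]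
  ring_nf

/-- The interpolant of a bounded function is continuous at time zero at its continuity points. -/
lemma tendsto_ouDensity_zero_of_bounded {g : ℝ → ℝ} (hg : Measurable g) {M : ℝ}
    (hM : ∀ s, |g s| ≤ M) {x : ℝ} (hx : ContinuousAt g x) :
    Tendsto (fun t => ouDensity g t x) (nhdsWithin 0 (Set.Ioi 0)) (nhds (g x)) := by
  have hlim : Tendsto (fun t => ∫ z, stdGaussianDensity z *
      (g ((x - Real.sqrt (1 - Real.exp (-2 * t)) * z) / Real.exp (-t)) / Real.exp (-t)))
      (nhdsWithin 0 (Set.Ioi 0)) (nhds (∫ z, stdGaussianDensity z * g x)) := by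
    refine tendsto_integral_filter_of_dominated_convergence
      (fun z => stdGaussianDensity z * (M * Real.exp 1)) ?_ ?_
      (integrable_stdGaussianDensity.mul_const _) ?_
    · refine Eventually.of_forall fun t => Measurable.aestronglyMeasurable ?_
      have := continuous_stdGaussianDensity.measurable
      fun_prop
    · have : ∀ᶠ t : ℝ in nhdsWithin 0 (Set.Ioi 0), t < 1 :=
        nhdsWithin_le_nhds (Iio_mem_nhds one_pos)
      filter_upwards [this] with t ht
      refine Eventually.of_forall fun z => ?_
      rw [norm_mul, Real.norm_eq_abs, abs_of_pos (stdGaussianDensity_pos z), norm_div,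
        Real.norm_eq_abs, Real.norm_eq_abs, abs_of_pos (Real.exp_pos _), div_eq_mul_inv,
        ← Real.exp_neg, neg_neg]
      have := stdGaussianDensity_pos z
      have hM0 : 0 ≤ M := (abs_nonneg _).trans (hM 0)
      gcongr
      exact hM _
    · refine Eventually.of_forall fun z => ?_
      have h1 : Tendsto (fun t : ℝ => (x - Real.sqrt (1 - Real.exp (-2 * t)) * z) / Real.exp (-t))
          (nhdsWithin 0 (Set.Ioi 0)) (nhds x) := by
        have h : Continuous fun t : ℝ =>
            (x - Real.sqrt (1 - Real.exp (-2 * t)) * z) / Real.exp (-t) := by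
          fun_prop (disch := simp)
        simpa using (h.tendsto 0).mono_left nhdsWithin_le_nhds
      have h2 : Tendsto (fun t : ℝ => Real.exp (-t)) (nhdsWithin 0 (Set.Ioi 0)) (nhds 1) := by
        have h : Continuous fun t : ℝ => Real.exp (-t) := by fun_prop
        simpa using (h.tendsto 0).mono_left nhdsWithin_le_nhds
      simpa using ((hx.tendsto.comp h1).div h2 one_ne_zero).const_mul (stdGaussianDensity z)
  rw [integral_mul_const, integral_stdGaussianDensity, one_mul] at hlim
  refine hlim.congr' ?_
  filter_upwards [self_mem_nhdsWithin] with t ht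
  exact (ouDensity_eq_integral_stdGaussianDensity g ht x).symm

/-- Mass located away from `x` does not contribute to the density at `x` as time tends to zero. -/
lemma tendsto_ouDensity_zero_of_vanishing {h : ℝ → ℝ} (hh : Integrable h) {x : ℝ}
    (hx : ∀ s, |s - x| < 1 → h s = 0) :
    Tendsto (fun t => ouDensity h t x) (nhdsWithin 0 (Set.Ioi 0)) (nhds 0) := by
  have hbd : ∀ᶠ t : ℝ in nhdsWithin 0 (Set.Ioi 0),
      1 / 2 < Real.exp (-t) - |x| * (1 - Real.exp (-t)) := by
    have hc : Continuous fun t : ℝ => Real.exp (-t) - |x| * (1 - Real.exp (-t)) := by fun_prop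
    refine nhdsWithin_le_nhds ((hc.tendsto 0).eventually_const_lt ?_)
    norm_num
  have hsq : Tendsto (fun t : ℝ => 8 * Real.sqrt (1 - Real.exp (-2 * t)) * ∫ s, ‖h s‖)
      (nhdsWithin 0 (Set.Ioi 0)) (nhds 0) := by
    simpa using (tendsto_sqrt_one_sub_exp_nhdsGT_zero.const_mul 8).mul_const (∫ s, ‖h s‖)
  refine squeeze_zero_norm' ?_ hsq
  filter_upwards [hbd, self_mem_nhdsWithin] with t ht ht0
  have hσ := Real.sqrt_pos.2 (one_sub_exp_neg_two_mul_pos ht0)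
  rw [ouDensity_eq_integral_kernel _ (ne_of_gt ht0), ← integral_const_mul]
  set σ := Real.sqrt (1 - Real.exp (-2 * t))
  refine norm_integral_le_of_norm_le (hh.norm.const_mul _) (Eventually.of_forall fun s => ?_)
  rw [norm_mul]
  rcases lt_or_ge |s - x| 1 with hs | hs
  · simp [hx s hs]
  refine mul_le_mul_of_nonneg_right ?_ (norm_nonneg _)
  rw [Real.norm_eq_abs, abs_of_pos (div_pos (stdGaussianDensity_pos _) hσ)]
  have he := Real.exp_pos (-t)
  have he1 : Real.exp (-t) < 1 := Real.exp_lt_one_iff.2 (neg_lt_zero.2 ht0)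
  have hv : 1 / 2 ≤ |x - Real.exp (-t) * s| := by
    have h1 : Real.exp (-t) * (s - x) = x * (1 - Real.exp (-t)) - (x - Real.exp (-t) * s) := by
      ring
    have h2 := abs_sub (x * (1 - Real.exp (-t))) (x - Real.exp (-t) * s)
    rw [← h1, abs_mul, abs_mul, abs_of_pos he, abs_of_pos (sub_pos.2 he1)] at h2
    nlinarith
  have h4 := sq_mul_stdGaussianDensity_le ((x - Real.exp (-t) * s) / σ)
  have h5 := stdGaussianDensity_pos ((x - Real.exp (-t) * s) / σ)
  rw [div_pow, div_mul_eq_mul_div, div_le_iff₀ (by positivity), ← sq_abs] at h4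
  rw [div_le_iff₀ hσ]
  have h6 : (1 / 2) ^ 2 ≤ |x - Real.exp (-t) * s| ^ 2 := by gcongr
  nlinarith

lemma tendsto_ouDensity_zero {f : ℝ → ℝ} (hc : Continuous f) (hf : Integrable f) (x : ℝ) :
    Tendsto (fun t => ouDensity f t x) (nhdsWithin 0 (Set.Ioi 0)) (nhds (f x)) := by
  set A := Metric.closedBall x 1 with hA
  have hAm : MeasurableSet A := Metric.isClosed_closedBall.measurableSet
  have hAx : A ∈ nhds x := Metric.closedBall_mem_nhds x one_pos
  obtain ⟨M, hM⟩ := (isCompact_closedBall x (1 : ℝ)).exists_bound_of_continuousOn hc.continuousOn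
  have hM0 : 0 ≤ M := (norm_nonneg _).trans (hM x (mem_of_mem_nhds hAx))
  have hg : Tendsto (fun t => ouDensity (A.indicator f) t x) (nhdsWithin 0 (Set.Ioi 0))
      (nhds (f x)) := by
    have := tendsto_ouDensity_zero_of_bounded (g := A.indicator f) (M := M) (x := x)
      (hc.measurable.indicator hAm) (fun s => ?_) ?_
    · rwa [Set.indicator_of_mem (mem_of_mem_nhds hAx)] at this
    · by_cases hs : s ∈ A
      · rw [Set.indicator_of_mem hs]
        exact hM s hs
      · simpa [Set.indicator_of_notMem hs] using hM0
    · refine hc.continuousAt.congr ?_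
      filter_upwards [hAx] with s hs
      exact (Set.indicator_of_mem hs f).symm
  have hh : Tendsto (fun t => ouDensity (Aᶜ.indicator f) t x) (nhdsWithin 0 (Set.Ioi 0))
      (nhds 0) := by
    refine tendsto_ouDensity_zero_of_vanishing (hf.indicator hAm.compl) fun s hs => ?_
    refine Set.indicator_of_notMem ?_ f
    simpa [hA, Real.dist_eq] using hs.le
  have hsum := hg.add hh
  rw [add_zero] at hsum
  refine hsum.congr' ?_
  filter_upwards [self_mem_nhdsWithin] with t ht
  rw [← ouDensity_add (hf.indicator hAm) (hf.indicator hAm.compl) (ne_of_gt ht),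
    Set.indicator_self_add_compl]

lemma continuousOn_ouDensity {f : ℝ → ℝ} (hc : Continuous f) (hf : Integrable f) (x : ℝ) :
    ContinuousOn (fun t => ouDensity f t x) (Set.Ici 0) := by
  intro t ht
  rcases eq_or_lt_of_le (Set.mem_Ici.1 ht) with rfl | ht
  · rw [← continuousWithinAt_Ioi_iff_Ici, ContinuousWithinAt]
    simpa [ouDensity] using tendsto_ouDensity_zero hc hf x
  · exact ((contDiffOn_ouDensity hf x).continuousOn.continuousAt
      (isOpen_Ioi.mem_nhds ht)).continuousWithinAt

/-- A continuous function with convex support has constant sign. -/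
lemma nonneg_of_convex_support {f : ℝ → ℝ} (hc : Continuous f)
    (hconv : Convex ℝ (Function.support f)) {a : ℝ} (ha : 0 < f a) : 0 ≤ f := by
  intro b
  by_contra! hb
  obtain ⟨c, hcs, hc0⟩ := hconv.isPreconnected.intermediate_value (f := f)
    (show b ∈ Function.support f from hb.ne) (show a ∈ Function.support f from ha.ne')
    hc.continuousOn (show (0 : ℝ) ∈ Set.Icc (f b) (f a) from ⟨hb.le, ha.le⟩)
  exact hcs hc0

lemma HasLebDensity.lintegral_eq_one {Ω : Type*} [MeasurableSpace Ω] {μ : Measure Ω}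
    [IsProbabilityMeasure μ] {S : Ω → ℝ} (hS : Measurable S) {f : ℝ → ℝ}
    (h : HasLebDensity μ S f) : ∫⁻ x, ENNReal.ofReal (f x) = 1 := by
  have := Measure.isProbabilityMeasure_map (μ := μ) hS.aemeasurable
  have h1 := measure_univ (μ := Measure.map S μ)
  rwa [h, withDensity_apply _ MeasurableSet.univ, Measure.restrict_univ] at h1

/-- regularity and positivity of `t ↦ √(f_{Z_t}(x))`. -/
theorem ou_density_sqrt_regular
    {Ω : Type*} [MeasurableSpace Ω] (μ : Measure Ω) [IsProbabilityMeasure μ]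
    (S : Ω → ℝ) (hSmeas : Measurable S)
    (fS : ℝ → ℝ) (hdens : HasLebDensity μ S fS)
    (hC1 : ContDiff ℝ 1 fS) (hconv : Convex ℝ (Function.support fS)) :
    ∀ x ∈ Function.support fS,
      ContinuousOn (fun t => Real.sqrt (ouDensity fS t x)) (Set.Ici 0) ∧
      ContDiffOn ℝ 1 (fun t => Real.sqrt (ouDensity fS t x)) (Set.Ioi 0) ∧
      ∀ t > (0 : ℝ), 0 < ouDensity fS t x := by
  have hc := hC1.continuous
  have hmass := hdens.lintegral_eq_one hSmeas
  obtain ⟨a, ha⟩ : ∃ a, 0 < fS a := by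
    by_contra! hneg
    simp [ENNReal.ofReal_of_nonpos (hneg _)] at hmass
  have h0 := nonneg_of_convex_support hc hconv ha
  have hf : Integrable fS := by
    rw [← lintegral_ofReal_ne_top_iff_integrable hc.aestronglyMeasurable
      (Eventually.of_forall h0), hmass]
    exact ENNReal.one_ne_top
  intro x hx
  have hpos : ∀ t > (0 : ℝ), 0 < ouDensity fS t x := fun t ht => ouDensity_pos hc hf h0 hx ht x
  exact ⟨(continuousOn_ouDensity hc hf x).sqrt,
    (contDiffOn_ouDensity hf x).sqrt fun t ht => (hpos t ht).ne', hpos⟩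

end
end

section
/- Let α = e^{19/300} π^{1/4}. Then for every integer m ≥ 1, √((2m+1)!) ≥ √(2m+1) · 2^m · m! / (m^{1/4} α) and √((2m)!) ≥ 2^m · m! / (m^{1/4} α); consequently, for every κ > 0, Σ_{odd k ≥ 3} 2^k κ^{k/2} √k / √(k!) ≤ 4α κ^{3/2} e^{2κ}, Σ_{odd k ≥ 3} 2^k κ^{k/2} / √(k!) ≤ 2α (e^{2κ} − 1) √(κ/3), and Σ_{even k ≥ 4} 2^k κ^{k/2} / √(k!) ≤ 2κ α (e^{2κ} − 1). -/
open Real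

noncomputable section

/-- The constant `α = e^{19/300} π^{1/4}`. -/
def alphaConst : ℝ := Real.exp (19 / 300) * Real.pi ^ ((1 : ℝ) / 4)

lemma alphaConst_pos : 0 < alphaConst := by unfold alphaConst; positivity

lemma two_le_alphaConst_sq : 2 ≤ alphaConst ^ 2 := by
  have h4 : alphaConst ^ 4 = Real.exp (19 / 75) * Real.pi := by
    unfold alphaConst
    rw [mul_pow, ← Real.exp_nat_mul, ← Real.rpow_mul_natCast Real.pi_pos.le]
    norm_num
  have hexp := Real.quadratic_le_exp_of_nonneg (x := 19 / 75) (by norm_num)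
  have hpi := Real.pi_gt_d2
  have h : (4 : ℝ) ≤ alphaConst ^ 4 := by rw [h4]; nlinarith
  nlinarith [sq_nonneg alphaConst]

lemma sixteen_pow_mul_factorial_pow_le (n : ℕ) :
    16 ^ (n + 1) * Nat.factorial (n + 1) ^ 4 ≤
      4 * (n + 1) * Nat.factorial (2 * (n + 1)) ^ 2 := by
  induction n with
  | zero => decide
  | succ n ih =>
    have h1 : Nat.factorial (n + 1 + 1) = (n + 2) * Nat.factorial (n + 1) :=
      Nat.factorial_succ _
    have h2 : Nat.factorial (2 * (n + 1 + 1)) =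
        (2 * n + 4) * ((2 * n + 3) * Nat.factorial (2 * (n + 1))) := by
      rw [show 2 * (n + 1 + 1) = 2 * (n + 1) + 1 + 1 by ring, Nat.factorial_succ,
        Nat.factorial_succ]
      ring
    rw [h1, h2]
    calc 16 ^ (n + 1 + 1) * ((n + 2) * Nat.factorial (n + 1)) ^ 4
        = 16 * (n + 2) ^ 4 * (16 ^ (n + 1) * Nat.factorial (n + 1) ^ 4) := by ring
      _ ≤ 16 * (n + 2) ^ 4 * (4 * (n + 1) * Nat.factorial (2 * (n + 1)) ^ 2) := by gcongr
      _ = 16 * (n + 2) ^ 3 * (4 * (n + 1) * (n + 2)) * Nat.factorial (2 * (n + 1)) ^ 2 := by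
        ring
      _ ≤ 16 * (n + 2) ^ 3 * (2 * n + 3) ^ 2 * Nat.factorial (2 * (n + 1)) ^ 2 := by
        gcongr; nlinarith
      _ = 4 * (n + 1 + 1) * ((2 * n + 4) * ((2 * n + 3) * Nat.factorial (2 * (n + 1)))) ^ 2 := by
        ring

lemma two_pow_mul_factorial_le {m : ℕ} (hm : 1 ≤ m) :
    2 ^ m * (Nat.factorial m : ℝ) ≤
      (m : ℝ) ^ ((1 : ℝ) / 4) * alphaConst * Real.sqrt (Nat.factorial (2 * m)) := by
  obtain ⟨n, rfl⟩ := Nat.exists_eq_add_of_le' hm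
  have hα := alphaConst_pos
  have hfac : (16 : ℝ) ^ (n + 1) * (Nat.factorial (n + 1) : ℝ) ^ 4 ≤
      4 * ((n + 1 : ℕ) : ℝ) * (Nat.factorial (2 * (n + 1)) : ℝ) ^ 2 := by
    exact_mod_cast sixteen_pow_mul_factorial_pow_le n
  have hα4 : (4 : ℝ) ≤ alphaConst ^ 4 := by
    nlinarith [two_le_alphaConst_sq]
  have hroot : (((n + 1 : ℕ) : ℝ) ^ ((1 : ℝ) / 4)) ^ 4 = ((n + 1 : ℕ) : ℝ) := by
    rw [← Real.rpow_mul_natCast (Nat.cast_nonneg _)]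
    norm_num
  have hsqrt : Real.sqrt (Nat.factorial (2 * (n + 1))) ^ 4 =
      (Nat.factorial (2 * (n + 1)) : ℝ) ^ 2 := by
    rw [show 4 = 2 * 2 from rfl, pow_mul, Real.sq_sqrt (Nat.cast_nonneg _)]
  refine le_of_pow_le_pow_left₀ (n := 4) (by norm_num) (by positivity) ?_
  calc (2 ^ (n + 1) * (Nat.factorial (n + 1) : ℝ)) ^ 4
      = 16 ^ (n + 1) * (Nat.factorial (n + 1) : ℝ) ^ 4 := by
        rw [mul_pow, ← pow_mul, mul_comm (n + 1) 4, pow_mul]; norm_num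
    _ ≤ 4 * ((n + 1 : ℕ) : ℝ) * (Nat.factorial (2 * (n + 1)) : ℝ) ^ 2 := hfac
    _ ≤ alphaConst ^ 4 * ((n + 1 : ℕ) : ℝ) * (Nat.factorial (2 * (n + 1)) : ℝ) ^ 2 := by gcongr
    _ = _ := by rw [mul_pow, mul_pow, hroot, hsqrt]; ring

lemma sqrt_factorial_two_mul_add_one (m : ℕ) :
    Real.sqrt (Nat.factorial (2 * m + 1)) =
      Real.sqrt (2 * (m : ℝ) + 1) * Real.sqrt (Nat.factorial (2 * m)) := by
  rw [Nat.factorial_succ, ← Real.sqrt_mul (by positivity)]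
  push_cast
  rfl

lemma even_term_le {κ : ℝ} (hκ : 0 < κ) {m : ℕ} (hm : 1 ≤ m) :
    (2 : ℝ) ^ (2 * m) * Real.sqrt κ ^ (2 * m) / Real.sqrt (Nat.factorial (2 * m)) ≤
      alphaConst * (m : ℝ) ^ ((1 : ℝ) / 4) * ((2 * κ) ^ m / Nat.factorial m) := by
  have h := two_pow_mul_factorial_le hm
  have hf : (0 : ℝ) < Nat.factorial m := by positivity
  rw [pow_mul (Real.sqrt κ), Real.sq_sqrt hκ.le, ← mul_div_assoc,
    div_le_div_iff₀ (by positivity) hf]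
  calc (2 : ℝ) ^ (2 * m) * κ ^ m * Nat.factorial m
      = (2 * κ) ^ m * (2 ^ m * Nat.factorial m) := by rw [mul_pow]; ring
    _ ≤ (2 * κ) ^ m * ((m : ℝ) ^ ((1 : ℝ) / 4) * alphaConst *
          Real.sqrt (Nat.factorial (2 * m))) := by gcongr
    _ = _ := by ring

lemma odd_term_le {κ : ℝ} (hκ : 0 < κ) {m : ℕ} (hm : 1 ≤ m) :
    (2 : ℝ) ^ (2 * m + 1) * Real.sqrt κ ^ (2 * m + 1) * Real.sqrt (2 * (m : ℝ) + 1) /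
        Real.sqrt (Nat.factorial (2 * m + 1)) ≤
      2 * alphaConst * Real.sqrt κ * (m : ℝ) ^ ((1 : ℝ) / 4) *
        ((2 * κ) ^ m / Nat.factorial m) := by
  have hs : (0 : ℝ) < Real.sqrt (2 * (m : ℝ) + 1) := by positivity
  have hF : (0 : ℝ) < Real.sqrt (Nat.factorial (2 * m)) := by positivity
  rw [sqrt_factorial_two_mul_add_one]
  calc _ = 2 * Real.sqrt κ * ((2 : ℝ) ^ (2 * m) * Real.sqrt κ ^ (2 * m) /
            Real.sqrt (Nat.factorial (2 * m))) := by field_simp; ring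
    _ ≤ 2 * Real.sqrt κ * (alphaConst * (m : ℝ) ^ ((1 : ℝ) / 4) *
          ((2 * κ) ^ m / Nat.factorial m)) := by gcongr; exact even_term_le hκ hm
    _ = _ := by ring

lemma rpow_one_fourth_le {m : ℕ} (hm : 1 ≤ m) : (m : ℝ) ^ ((1 : ℝ) / 4) ≤ m :=
  Real.rpow_le_self_of_one_le (by exact_mod_cast hm) (by norm_num)

lemma sqrt_three_mul_rpow_one_fourth_le (m : ℕ) :
    Real.sqrt 3 * (m : ℝ) ^ ((1 : ℝ) / 4) ≤ Real.sqrt (2 * (m : ℝ) + 1) := by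
  apply Real.le_sqrt_of_sq_le
  have hroot : ((m : ℝ) ^ ((1 : ℝ) / 4)) ^ 4 = m := by
    rw [← Real.rpow_mul_natCast (Nat.cast_nonneg _)]
    norm_num
  rw [mul_pow, Real.sq_sqrt (by norm_num)]
  set r := (m : ℝ) ^ ((1 : ℝ) / 4)
  rcases Nat.eq_zero_or_pos m with h | h
  · have : r = 0 := by simp [r, h]
    rw [this, zero_pow two_ne_zero, mul_zero]; positivity
  · have : 1 ≤ r := Real.one_le_rpow (by exact_mod_cast h) (by norm_num)
    nlinarith [one_le_pow₀ this (n := 2)]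

lemma pow_succ_div_factorial_mul (x : ℝ) (n : ℕ) :
    ((n + 1 : ℕ) : ℝ) * (x ^ (n + 1) / Nat.factorial (n + 1)) = x * (x ^ n / Nat.factorial n) := by
  have : (0 : ℝ) < Nat.factorial n := by positivity
  rw [Nat.factorial_succ]
  push_cast
  field_simp
  ring

lemma hasSum_pow_div_factorial (x : ℝ) :
    HasSum (fun n : ℕ => x ^ n / Nat.factorial n) (Real.exp x) := by
  rw [Real.exp_eq_exp_ℝ]
  exact NormedSpace.expSeries_div_hasSum_exp x

lemma hasSum_pow_succ_div_factorial (x : ℝ) :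
    HasSum (fun n : ℕ => x ^ (n + 1) / Nat.factorial (n + 1)) (Real.exp x - 1) := by
  simpa using (hasSum_nat_add_iff' 1).mpr (hasSum_pow_div_factorial x)

lemma tsum_le_of_nonneg_of_le_hasSum {f g : ℕ → ℝ} {S : ℝ} (hf : ∀ n, 0 ≤ f n)
    (hfg : ∀ n, f n ≤ g n) (hg : HasSum g S) : ∑' n, f n ≤ S :=
  hasSum_le hfg (Summable.of_nonneg_of_le hf hfg hg.summable).hasSum hg

/-- Stirling-type factorial lower bounds and the resulting Hermite-sum bounds. -/
theorem stirling_hermite_sum_bounds :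
    (∀ m : ℕ, 1 ≤ m →
      Real.sqrt (Nat.factorial (2 * m + 1)) ≥
          Real.sqrt (2 * (m : ℝ) + 1) * 2 ^ m * (Nat.factorial m : ℝ) /
            ((m : ℝ) ^ ((1 : ℝ) / 4) * alphaConst) ∧
      Real.sqrt (Nat.factorial (2 * m)) ≥
          2 ^ m * (Nat.factorial m : ℝ) / ((m : ℝ) ^ ((1 : ℝ) / 4) * alphaConst)) ∧
    (∀ κ : ℝ, 0 < κ →
      (∑' m : ℕ, (2 : ℝ) ^ (2 * m + 3) * Real.sqrt κ ^ (2 * m + 3) *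
            Real.sqrt (2 * (m : ℝ) + 3) / Real.sqrt (Nat.factorial (2 * m + 3)))
          ≤ 4 * alphaConst * κ ^ ((3 : ℝ) / 2) * Real.exp (2 * κ) ∧
      (∑' m : ℕ, (2 : ℝ) ^ (2 * m + 3) * Real.sqrt κ ^ (2 * m + 3) /
            Real.sqrt (Nat.factorial (2 * m + 3)))
          ≤ 2 * alphaConst * (Real.exp (2 * κ) - 1) * Real.sqrt (κ / 3) ∧
      (∑' m : ℕ, (2 : ℝ) ^ (2 * m + 4) * Real.sqrt κ ^ (2 * m + 4) /
            Real.sqrt (Nat.factorial (2 * m + 4)))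
          ≤ 2 * κ * alphaConst * (Real.exp (2 * κ) - 1)) := by
  have hα := alphaConst_pos
  refine ⟨fun m hm => ?_, fun κ hκ => ⟨?_, ?_, ?_⟩⟩
  · have hm0 : (0 : ℝ) < m := by exact_mod_cast hm
    have h : 2 ^ m * (Nat.factorial m : ℝ) / ((m : ℝ) ^ ((1 : ℝ) / 4) * alphaConst) ≤
        Real.sqrt (Nat.factorial (2 * m)) := by
      rw [div_le_iff₀' (by positivity)]
      exact two_pow_mul_factorial_le hm
    refine ⟨?_, h⟩
    rw [sqrt_factorial_two_mul_add_one, mul_assoc, mul_div_assoc]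
    exact mul_le_mul_of_nonneg_left h (Real.sqrt_nonneg _)
  · have hpow : κ ^ ((3 : ℝ) / 2) = κ * Real.sqrt κ := by
      rw [Real.sqrt_eq_rpow, ← Real.rpow_one_add' hκ.le (by norm_num)]
      norm_num
    refine tsum_le_of_nonneg_of_le_hasSum (fun n => by positivity) (fun n => ?_)
      ((hasSum_pow_div_factorial (2 * κ)).mul_left (4 * alphaConst * κ ^ ((3 : ℝ) / 2)))
    have h := odd_term_le hκ (Nat.le_add_left 1 n)
    rw [show 2 * ((n + 1 : ℕ) : ℝ) + 1 = 2 * (n : ℝ) + 3 by push_cast; ring] at h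
    calc _ ≤ _ := h
      _ ≤ 2 * alphaConst * Real.sqrt κ * ((n + 1 : ℕ) : ℝ) *
            ((2 * κ) ^ (n + 1) / Nat.factorial (n + 1)) := by
          gcongr; exact rpow_one_fourth_le (Nat.le_add_left 1 n)
      _ = 2 * alphaConst * Real.sqrt κ * (2 * κ * ((2 * κ) ^ n / Nat.factorial n)) := by
          rw [mul_assoc, pow_succ_div_factorial_mul]
      _ = _ := by rw [hpow]; ring
  · rw [mul_right_comm]
    refine tsum_le_of_nonneg_of_le_hasSum (fun n => by positivity) (fun n => ?_)
      ((hasSum_pow_succ_div_factorial (2 * κ)).mul_left (2 * alphaConst * Real.sqrt (κ / 3)))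
    have h := odd_term_le hκ (Nat.le_add_left 1 n)
    have hr := sqrt_three_mul_rpow_one_fourth_le (n + 1)
    have hs : (0 : ℝ) < Real.sqrt (2 * ((n + 1 : ℕ) : ℝ) + 1) := by positivity
    have h3 : (0 : ℝ) < Real.sqrt 3 := by positivity
    rw [mul_div_right_comm] at h
    refine le_of_mul_le_mul_right (h.trans ?_) hs
    rw [Real.sqrt_div hκ.le]
    calc 2 * alphaConst * Real.sqrt κ * ((n + 1 : ℕ) : ℝ) ^ ((1 : ℝ) / 4) *
          ((2 * κ) ^ (n + 1) / Nat.factorial (n + 1))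
        = 2 * alphaConst * (Real.sqrt κ / Real.sqrt 3) *
            ((2 * κ) ^ (n + 1) / Nat.factorial (n + 1)) *
            (Real.sqrt 3 * ((n + 1 : ℕ) : ℝ) ^ ((1 : ℝ) / 4)) := by
          field_simp
      _ ≤ _ := by gcongr
  · rw [mul_right_comm 2 κ, mul_assoc (2 * alphaConst), mul_comm κ, ← mul_assoc,
      mul_right_comm]
    refine tsum_le_of_nonneg_of_le_hasSum (fun n => by positivity) (fun n => ?_)
      ((hasSum_pow_succ_div_factorial (2 * κ)).mul_left (2 * alphaConst * κ))
    calc _ ≤ _ := even_term_le hκ (m := n + 2) (by omega)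
      _ ≤ alphaConst * ((n + 1 + 1 : ℕ) : ℝ) *
            ((2 * κ) ^ (n + 1 + 1) / Nat.factorial (n + 1 + 1)) := by
          gcongr; exact rpow_one_fourth_le (by omega)
      _ = alphaConst * (2 * κ * ((2 * κ) ^ (n + 1) / Nat.factorial (n + 1))) := by
          rw [mul_assoc, pow_succ_div_factorial_mul]
      _ = _ := by ring

end
end
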